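/- Let u_1, …, u_n be positive integers and t, k positive integers such that u_i < t for every i, k < n, and every subset S ⊆ {1,…,n} with |S| < k satisfies Σ_{i∈S} u_i < t. Let E be the PB instance with projects C = {p, c_1,…,c_n, d_1,…,d_{k+1}}, costs cost(p) = t, cost(c_i) = u_i, cost(d_j) = t + 1, a single voter who approves exactly the projects in C ∖ {p}, budget B = u_1 + … + u_n, and GreedyCost run with a tie-breaking order ≻ whose most-preferred element is p. For every S ⊆ {1,…,n} with |S| ≤ k, letting y = Σ_{i∈S} u_i and E' be the instance obtained from E by removing the voter's approval of each c_i with i ∈ S: p ∈ GreedyCost(E') if and only if y = t. -/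

import Mathlib

structure PB (C V : Type) [Fintype C] [DecidableEq C] [Fintype V] [DecidableEq V] where
  A : V → Finset C
  budget : ℕ
  cost : C → ℕ

namespace PB

variable {C V : Type} [Fintype C] [DecidableEq C] [Fintype V] [DecidableEq V]

/-- The approval score of a project: the number of voters approving it. -/
def score (E : PB C V) (c : C) : ℕ :=
  (Finset.univ.filter fun v => c ∈ E.A v).card

/-- Perform the approval flips in `F`: voter `v`'s approval set becomes
`A v ∆ {c : (v, c) ∈ F}`. -/
def flip (E : PB C V) (F : Finset (V × C)) : PB C V :=
  { E with A := fun v => symmDiff (E.A v) ((F.filter fun q => q.1 = v).image Prod.snd) }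

/-- Greedily process the given list of projects: starting from `W = ∅`,
add the currently considered project whenever it fits in the budget. -/
def greedyFold (budget : ℕ) (cost : C → ℕ) (order : List C) : Finset C :=
  order.foldl (fun W c => if (∑ x ∈ W, cost x) + cost c ≤ budget then insert c W else W) ∅

/-- The order in which GreedyAV considers the projects: non-increasing approval
score, ties broken in favor of `prec`-earlier projects. -/
noncomputable def consOrderAV (E : PB C V) (prec : C → C → Bool) : List C :=
  (Finset.univ : Finset C).toList.mergeSort fun c c' =>
    decide (E.score c' < E.score c) ||
      (decide (E.score c = E.score c') && (prec c c' || decide (c = c')))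

/-- GreedyAV with tie-breaking given by the strict relation `prec`. -/
noncomputable def greedyAV (E : PB C V) (prec : C → C → Bool) : Finset C :=
  greedyFold E.budget E.cost (consOrderAV E prec)

/-- The order in which GreedyCost considers the projects: non-increasing
approval-score-to-cost ratio (compared by cross-multiplication), ties broken in
favor of `prec`-earlier projects. -/
noncomputable def consOrderCost (E : PB C V) (prec : C → C → Bool) : List C :=
  (Finset.univ : Finset C).toList.mergeSort fun c c' =>
    decide (E.score c' * E.cost c < E.score c * E.cost c') ||
      (decide (E.score c * E.cost c' = E.score c' * E.cost c) && (prec c c' || decide (c = c')))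

/-- GreedyCost with tie-breaking given by the strict relation `prec`. -/
noncomputable def greedyCost (E : PB C V) (prec : C → C → Bool) : Finset C :=
  greedyFold E.budget E.cost (consOrderCost E prec)

/-- Cheaper-first tie-breaking: ties in approval score are broken in favor of
the cheaper project, with remaining ties broken by the residual order `prec0`. -/
def cheaperFirst (cost : C → ℕ) (prec0 : C → C → Bool) : C → C → Bool :=
  fun c c' => decide (cost c < cost c') || (decide (cost c = cost c') && prec0 c c')

end PB

/-! The reduction from Sized Subset Sum to GreedyCost-Flip-Bribery
(Theorem `greedycost-pb-npc`). -/

/-- The projects: `p`, `c_1, …, c_n`, and the dummy projects `d_1, …, d_{k+1}`. -/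
abbrev Proj8 (n k : ℕ) := Unit ⊕ (Fin n ⊕ Fin (k + 1))

/-- The preferred project `p`. -/
def pProj8 (n k : ℕ) : Proj8 n k := Sum.inl ()

/-- Costs: `cost(p) = t`, `cost(c_i) = u_i`, `cost(d_j) = t + 1`. -/
def cost8 {n : ℕ} (u : Fin n → ℕ) (t k : ℕ) : Proj8 n k → ℕ
  | .inl _ => t
  | .inr (.inl i) => u i
  | .inr (.inr _) => t + 1

/-- The PB instance: a single voter approving everything except `p`, and
budget `B = u_1 + … + u_n`. -/
def E8 {n : ℕ} (u : Fin n → ℕ) (t k : ℕ) : PB (Proj8 n k) Unit where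
  A := fun _ => Finset.univ.erase (Sum.inl ())
  budget := ∑ j, u j
  cost := cost8 u t k

namespace PB

section GreedyFold

variable {C : Type} [DecidableEq C] (b : ℕ) (cost : C → ℕ)

theorem greedyFold_concat (l : List C) (c : C) :
    greedyFold b cost (l ++ [c]) =
      if (∑ x ∈ greedyFold b cost l, cost x) + cost c ≤ b
      then insert c (greedyFold b cost l) else greedyFold b cost l := by
  rw [greedyFold, List.foldl_append]
  rfl

theorem greedyFold_subset_append (l m : List C) :
    greedyFold b cost l ⊆ greedyFold b cost (l ++ m) := by
  induction m using List.reverseRecOn with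
  | nil => simp
  | append_singleton m c ih =>
    rw [← List.append_assoc, greedyFold_concat]
    split_ifs
    · exact ih.trans (Finset.subset_insert _ _)
    · exact ih

theorem mem_of_mem_greedyFold {l : List C} {x : C} (hx : x ∈ greedyFold b cost l) : x ∈ l := by
  induction l using List.reverseRecOn with
  | nil => simp [greedyFold] at hx
  | append_singleton l c ih =>
    rw [greedyFold_concat] at hx
    split_ifs at hx <;> grind

theorem mem_of_mem_greedyFold_append {l m : List C} {x : C}
    (hx : x ∈ greedyFold b cost (l ++ m)) (hm : x ∉ m) : x ∈ greedyFold b cost l := by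
  induction m using List.reverseRecOn with
  | nil => simpa using hx
  | append_singleton m c ih =>
    rw [← List.append_assoc, greedyFold_concat] at hx
    split_ifs at hx <;> grind

theorem sum_greedyFold_le (l : List C) : ∑ x ∈ greedyFold b cost l, cost x ≤ b := by
  induction l using List.reverseRecOn with
  | nil => simp [greedyFold]
  | append_singleton l c ih =>
    rw [greedyFold_concat]
    split_ifs with h
    · by_cases hc : c ∈ greedyFold b cost l
      · rwa [Finset.insert_eq_of_mem hc]
      · rw [Finset.sum_insert hc]
        lia
    · exact ih

/-- In a duplicate-free order, a project is selected exactly if it fits when it is considered. -/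
theorem mem_greedyFold_append_cons {l m : List C} {c : C} (h : (l ++ c :: m).Nodup) :
    c ∈ greedyFold b cost (l ++ c :: m) ↔
      (∑ x ∈ greedyFold b cost l, cost x) + cost c ≤ b := by
  have hl : c ∉ l := by grind
  have hm : c ∉ m := by grind
  have e : l ++ c :: m = (l ++ [c]) ++ m := by simp
  have key := greedyFold_concat b cost l c
  constructor
  · intro hc
    rw [e] at hc
    have hc' := mem_of_mem_greedyFold_append b cost hc hm
    rw [key] at hc'
    split_ifs at hc' with hle
    · exact hle
    · exact absurd (mem_of_mem_greedyFold b cost hc') hl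
  · intro hle
    rw [e]
    refine greedyFold_subset_append b cost _ _ ?_
    rw [key, if_pos hle]
    exact Finset.mem_insert_self _ _

end GreedyFold

section ConsOrderCost

variable {C V : Type} [Fintype C] [DecidableEq C] [Fintype V] [DecidableEq V]

theorem nodup_consOrderCost (E : PB C V) (prec : C → C → Bool) : (consOrderCost E prec).Nodup :=
  (List.mergeSort_perm _ _).nodup_iff.2 (Finset.nodup_toList _)

theorem mem_consOrderCost (E : PB C V) (prec : C → C → Bool) (c : C) :
    c ∈ consOrderCost E prec := by
  simp [consOrderCost]

theorem pairwise_consOrderCost (E : PB C V) (prec : C → C → Bool) (hcost : ∀ c, 0 < E.cost c)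
    (hprec : IsStrictTotalOrder C fun a b => prec a b = true) :
    (consOrderCost E prec).Pairwise fun c c' =>
      E.score c' * E.cost c < E.score c * E.cost c' ∨
        E.score c * E.cost c' = E.score c' * E.cost c ∧ (prec c c' = true ∨ c = c') := by
  have hlt (c c' : C) : E.score c' * E.cost c < E.score c * E.cost c' ↔
      (E.score c' / E.cost c' : ℚ) < E.score c / E.cost c := by
    have h := hcost c
    have h' := hcost c'
    rw [div_lt_div_iff₀ (by positivity) (by positivity)]
    norm_cast
  have heq (c c' : C) : E.score c * E.cost c' = E.score c' * E.cost c ↔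
      (E.score c / E.cost c : ℚ) = E.score c' / E.cost c' := by
    have h := hcost c
    have h' := hcost c'
    rw [div_eq_div_iff (by positivity) (by positivity)]
    norm_cast
  have h := List.pairwise_mergeSort (le := fun c c' =>
    decide (E.score c' * E.cost c < E.score c * E.cost c') ||
      (decide (E.score c * E.cost c' = E.score c' * E.cost c) && (prec c c' || decide (c = c'))))
    (fun x y z => ?_) (fun x y => ?_) (Finset.univ : Finset C).toList
  · refine h.imp fun {c c'} hc => ?_
    simpa using hc
  · simp only [hlt, heq, Bool.or_eq_true, Bool.and_eq_true, decide_eq_true_eq]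
    have := hprec.trans x y z
    rintro (h1 | ⟨h1, h1'⟩) (h2 | ⟨h2, h2'⟩)
    · exact .inl (h2.trans h1)
    · exact .inl (h2 ▸ h1)
    · exact .inl (h1 ▸ h2)
    · exact .inr ⟨h1.trans h2, by grind⟩
  · simp only [hlt, heq, Bool.or_eq_true, Bool.and_eq_true, decide_eq_true_eq]
    have := trichotomous_of (fun a b => prec a b = true) x y
    rcases lt_trichotomy (E.score x / E.cost x : ℚ) (E.score y / E.cost y) with h | h | h
    · exact .inr (.inl h)
    · rcases this with h' | h' | h'
      · exact .inl (.inr ⟨h, .inl h'⟩)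
      · exact .inl (.inr ⟨h, .inr h'⟩)
      · exact .inr (.inr ⟨h.symm, .inl h'⟩)
    · exact .inl (.inl h)

end ConsOrderCost

end PB

theorem stmt10 (n k t : ℕ) (u : Fin n → ℕ) (hu : ∀ i, 0 < u i)
    (ht : 0 < t) (hk : 0 < k) (hut : ∀ i, u i < t) (hkn : k < n)
    (hsmall : ∀ S : Finset (Fin n), S.card < k → ∑ i ∈ S, u i < t)
    (prec : Proj8 n k → Proj8 n k → Bool)
    (hlin : IsStrictTotalOrder (Proj8 n k) fun a b => prec a b = true)
    (hpfirst : ∀ c : Proj8 n k, c ≠ pProj8 n k → prec (pProj8 n k) c = true)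
    (S : Finset (Fin n)) (hS : S.card ≤ k) :
    pProj8 n k ∈ PB.greedyCost
        ({ E8 u t k with
            A := fun _ =>
              (E8 u t k).A () \ S.image fun i => (Sum.inr (Sum.inl i) : Proj8 n k) } :
          PB (Proj8 n k) Unit)
        prec ↔
      ∑ i ∈ S, u i = t := by
  set E : PB (Proj8 n k) Unit := { E8 u t k with
    A := fun _ => (E8 u t k).A () \ S.image fun i => (Sum.inr (Sum.inl i) : Proj8 n k) } with hE
  let p : Proj8 n k := Sum.inl ()
  let c : Fin n → Proj8 n k := fun i => Sum.inr (Sum.inl i)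
  let d : Fin (k + 1) → Proj8 n k := fun j => Sum.inr (Sum.inr j)
  have costp : E.cost p = t := rfl
  have costc (i : Fin n) : E.cost (c i) = u i := rfl
  have costd (j : Fin (k + 1)) : E.cost (d j) = t + 1 := rfl
  have budget : E.budget = ∑ i, u i := rfl
  have scorep : E.score p = 0 := by simp [PB.score, hE, E8, p]
  have scorec (i : Fin n) : E.score (c i) = if i ∈ S then 0 else 1 := by
    split_ifs with hi <;> simp [PB.score, hE, E8, c, hi]
  have scored (j : Fin (k + 1)) : E.score (d j) = 1 := by simp [PB.score, hE, E8, d]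
  have hcost (x : Proj8 n k) : 0 < E.cost x := by
    rcases x with _ | i | j
    exacts [ht, hu i, Nat.succ_pos t]
  have hcases (x : Proj8 n k) : x = p ∨ (∃ i, x = c i) ∨ ∃ j, x = d j := by
    rcases x with _ | i | j
    exacts [.inl rfl, .inr (.inl ⟨i, rfl⟩), .inr (.inr ⟨j, rfl⟩)]
  have hsort := PB.pairwise_consOrderCost E prec hcost hlin
  have hnodup := PB.nodup_consOrderCost E prec
  have hmem := PB.mem_consOrderCost E prec
  have hasymm (x : Proj8 n k) : x ≠ p → ¬ prec x p = true := fun hx h =>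
    hlin.irrefl x (hlin.trans _ _ _ h (hpfirst x hx))
  change p ∈ PB.greedyFold E.budget E.cost (PB.consOrderCost E prec) ↔ _
  obtain ⟨l, m, hlm⟩ := List.append_of_mem (hmem p)
  rw [hlm] at hsort hnodup hmem ⊢
  rw [PB.mem_greedyFold_append_cons _ _ hnodup, costp]
  rw [List.pairwise_append, List.pairwise_cons] at hsort
  obtain ⟨hl, ⟨hpm, -⟩, hlp⟩ := hsort
  have hl_nodup : l.Nodup := (List.nodup_append.1 hnodup).1
  have hp_notMem : p ∉ l := by grind
  have mem_l (x : Proj8 n k) : x ∈ l ↔ 0 < E.score x := by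
    constructor
    · intro hx
      have := hlp x hx p (by simp)
      rw [scorep] at this
      by_contra! h0
      have : x ≠ p := by grind
      have := hasymm x this
      simp_all
    · intro hx
      by_contra hxl
      have hxp : x ≠ p := by rintro rfl; lia
      have hxm : x ∈ m := by have := hmem x; grind
      have := hpm x hxm
      have := Nat.mul_pos hx ht
      simp only [scorep, costp] at *
      lia
  set W := PB.greedyFold E.budget E.cost l with hW
  have hWB : ∑ x ∈ W, E.cost x ≤ E.budget := PB.sum_greedyFold_le _ _ _
  have hcinj : Function.Injective c := fun i j h => by simpa [c] using h
  let Q : Finset (Proj8 n k) := Sᶜ.image c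
  have hQ : ∑ x ∈ Q, E.cost x = ∑ i ∈ Sᶜ, u i := by
    rw [Finset.sum_image hcinj.injOn]
    simp only [costc]
  have hsum : ∑ i ∈ S, u i + ∑ i ∈ Sᶜ, u i = ∑ i, u i := Finset.sum_add_sum_compl S u
  have hQW : Q ⊆ W := by
    intro x hx
    obtain ⟨i, hi, rfl⟩ := Finset.mem_image.1 hx
    have hiS : i ∉ S := by simpa using hi
    have hil : c i ∈ l := by simp [mem_l, scorec, hiS]
    obtain ⟨a, b, rfl⟩ := List.append_of_mem hil
    rw [hW, PB.mem_greedyFold_append_cons _ _ hl_nodup]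
    have hci : c i ∉ PB.greedyFold E.budget E.cost a := fun h => by
      have := PB.mem_of_mem_greedyFold _ _ h
      grind
    rw [add_comm, ← Finset.sum_insert hci]
    have hsub : insert (c i) (PB.greedyFold E.budget E.cost a) ⊆ Q := by
      refine Finset.insert_subset hx fun y hy => ?_
      have hya := PB.mem_of_mem_greedyFold _ _ hy
      have hyl := (mem_l y).1 (by simp [hya])
      rcases hcases y with rfl | ⟨j, rfl⟩ | ⟨j, rfl⟩
      · lia
      · refine Finset.mem_image_of_mem c ?_
        by_contra hj
        simp_all
      · have := (List.pairwise_append.1 hl).2.2 _ hya (c i) (by simp)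
        have := hut i
        simp only [scored, scorec, costc, costd, if_neg hiS] at *
        lia
    have := Finset.sum_le_sum_of_subset (f := E.cost) hsub
    lia
  have hd_notMem (j : Fin (k + 1)) : d j ∉ Q := by simp [Q, c, d]
  have hWQ (h : ∀ j, d j ∉ W) : W = Q := by
    refine Finset.Subset.antisymm (fun x hx => ?_) hQW
    have hxl := (mem_l x).1 (PB.mem_of_mem_greedyFold _ _ hx)
    rcases hcases x with rfl | ⟨i, rfl⟩ | ⟨j, rfl⟩
    · lia
    · refine Finset.mem_image_of_mem c ?_
      by_contra hi
      simp_all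
    · exact absurd hx (h j)
  have hWd (j : Fin (k + 1)) (hj : d j ∈ W) :
      ∑ i ∈ Sᶜ, u i + (t + 1) ≤ ∑ x ∈ W, E.cost x := by
    rw [← hQ, ← costd j, add_comm, ← Finset.sum_insert (hd_notMem j)]
    exact Finset.sum_le_sum_of_subset (Finset.insert_subset hj hQW)
  rcases le_or_gt (∑ i ∈ S, u i) t with hy | hy
  · have : W = Q := hWQ fun j hj => by
      have := hWd j hj
      lia
    rw [this, hQ]
    lia
  · obtain ⟨j, hj⟩ : ∃ j, d j ∈ W := by
      by_contra! hd
      have hWQ := hWQ hd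
      have hd0 := hd 0
      have hd0l : d 0 ∈ l := (mem_l (d 0)).2 (by simp [scored])
      obtain ⟨a, b, hab⟩ := List.append_of_mem hd0l
      have hsub : PB.greedyFold E.budget E.cost a ⊆ W :=
        hW ▸ hab ▸ PB.greedyFold_subset_append E.budget E.cost a (d 0 :: b)
      rw [hW, hab, PB.mem_greedyFold_append_cons _ _ (hab ▸ hl_nodup), costd] at hd0
      have := Finset.sum_le_sum_of_subset (f := E.cost) hsub
      rw [hWQ, hQ] at this
      lia
    have := hWd j hj
    have hSne : S.Nonempty := by
      rw [Finset.nonempty_iff_ne_empty]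
      rintro rfl
      simp at hy
    obtain ⟨i, hi⟩ := hSne
    have := hsmall (S.erase i) (by rw [Finset.card_erase_of_mem hi]; lia)
    have := Finset.add_sum_erase S u hi
    have := hut i
    lia
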